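/- Let W_AI = {Q(q1,q2,p1,p2,r1,r2) ∈ W : p1 = p2} be the asymptotically-isothermic tableau, a 5-dimensional subspace of the Fubini–Cartan tableau W. Then its first prolongation W_AI^(1) has dimension 5, and for all real λ, μ with λ·μ·(λ³ + μ³) ≠ 0 the subspace {Q ∈ W_AI : Q(λ·e1 + μ·e2) = 0} is zero. Hence W_AI is involutive with characters s'_1 = 5 and s'_2 = 0. -/

import Mathlib

set_option synthInstance.maxHeartbeats 1000000
set_option maxHeartbeats 1000000

open Module

noncomputable instance innerHomAddCommGroup :
    AddCommGroup ((Fin 2 → ℝ) →ₗ[ℝ] (Fin 5 → ℝ)) :=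
  @LinearMap.addCommGroup ℝ ℝ (Fin 2 → ℝ) (Fin 5 → ℝ) _ _ _ _ _ _ (RingHom.id ℝ)

noncomputable instance outerHomAddCommGroup :
    AddCommGroup ((Fin 2 → ℝ) →ₗ[ℝ] ((Fin 2 → ℝ) →ₗ[ℝ] (Fin 5 → ℝ))) :=
  @LinearMap.addCommGroup ℝ ℝ (Fin 2 → ℝ) ((Fin 2 → ℝ) →ₗ[ℝ] (Fin 5 → ℝ))
    _ _ _ _ _ _ (RingHom.id ℝ)

noncomputable instance outerHomSubAddCommGroup
    (P : Submodule ℝ ((Fin 2 → ℝ) →ₗ[ℝ] ((Fin 2 → ℝ) →ₗ[ℝ] (Fin 5 → ℝ)))) :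
    AddCommGroup ↥P := by exact @Submodule.addCommGroup ℝ _ _ _ _ P

/-- The first standard basis vector `e1` of `a = ℝ²`. -/
noncomputable def e1 : Fin 2 → ℝ := Pi.single 0 1
/-- The second standard basis vector `e2` of `a = ℝ²`. -/
noncomputable def e2 : Fin 2 → ℝ := Pi.single 1 1

/-- `memW Q q1 q2 p1 p2 r1 r2` says that `Q ∈ Hom(ℝ², ℝ⁵)` is the element
`Q(q1,q2,p1,p2,r1,r2)` of the Fubini–Cartan tableau, i.e.
`Q(e1) = (−(3/2)q1, (1/2)q1, r1, p1, r2)` and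
`Q(e2) = ((3/2)q2, (1/2)q2, p2, r2, r1)`. -/
def memW (Q : (Fin 2 → ℝ) →ₗ[ℝ] (Fin 5 → ℝ))
    (q1 q2 p1 p2 r1 r2 : ℝ) : Prop :=
  Q e1 = ![-(3/2) * q1, (1/2) * q1, r1, p1, r2] ∧
  Q e2 = ![(3/2) * q2, (1/2) * q2, p2, r2, r1]

/-- The Fubini–Cartan tableau `W ⊆ Hom(ℝ², ℝ⁵)`, the 6-dimensional subspace
of all `Q(q1,q2,p1,p2,r1,r2)` for `(q1,q2,p1,p2,r1,r2) ∈ ℝ⁶`. -/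
noncomputable def W : Submodule ℝ ((Fin 2 → ℝ) →ₗ[ℝ] (Fin 5 → ℝ)) where
  carrier := {Q | ∃ q1 q2 p1 p2 r1 r2 : ℝ, memW Q q1 q2 p1 p2 r1 r2}
  add_mem' := by
    rintro Q Q' ⟨a1, a2, a3, a4, a5, a6, h1, h2⟩ ⟨b1, b2, b3, b4, b5, b6, k1, k2⟩
    refine ⟨a1 + b1, a2 + b2, a3 + b3, a4 + b4, a5 + b5, a6 + b6, ?_, ?_⟩ <;>
      · simp only [LinearMap.add_apply, h1, h2, k1, k2]
        funext i; fin_cases i <;> simp <;> ring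
  zero_mem' := by
    refine ⟨0, 0, 0, 0, 0, 0, ?_, ?_⟩ <;>
      · funext i; fin_cases i <;> simp
  smul_mem' := by
    rintro c Q ⟨a1, a2, a3, a4, a5, a6, h1, h2⟩
    refine ⟨c * a1, c * a2, c * a3, c * a4, c * a5, c * a6, ?_, ?_⟩ <;>
      · simp only [LinearMap.smul_apply, h1, h2]
        funext i; fin_cases i <;> simp <;> ring

/-- The first prolongation `T⁽¹⁾ = {F ∈ Hom(ℝ², T) : F(e1)(e2) = F(e2)(e1)}`
of a linear subspace `T ⊆ Hom(ℝ², ℝ⁵)`, where `Hom(ℝ², T)` is realized as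
the space of linear maps `ℝ² → Hom(ℝ², ℝ⁵)` all of whose values lie in `T`. -/
noncomputable def prolong (T : Submodule ℝ ((Fin 2 → ℝ) →ₗ[ℝ] (Fin 5 → ℝ))) :
    Submodule ℝ ((Fin 2 → ℝ) →ₗ[ℝ] ((Fin 2 → ℝ) →ₗ[ℝ] (Fin 5 → ℝ))) where
  carrier := {F | (∀ v, F v ∈ T) ∧ F e1 e2 = F e2 e1}
  add_mem' := by
    rintro F G ⟨hF1, hF2⟩ ⟨hG1, hG2⟩
    exact ⟨fun v => T.add_mem (hF1 v) (hG1 v), by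
      simp [LinearMap.add_apply, hF2, hG2]⟩
  zero_mem' := ⟨fun v => T.zero_mem, by simp⟩
  smul_mem' := by
    rintro c F ⟨hF1, hF2⟩
    exact ⟨fun v => T.smul_mem c (hF1 v), by
      simp [LinearMap.smul_apply, hF2]⟩

/-- The subspace `{Q ∈ T : Q(v) = 0}` of a linear subspace
`T ⊆ Hom(ℝ², ℝ⁵)`: the elements of `T` vanishing on (the line spanned by)
`v`, i.e. on the first subspace of the flag determined by `v`. -/
noncomputable def vanishAt (T : Submodule ℝ ((Fin 2 → ℝ) →ₗ[ℝ] (Fin 5 → ℝ)))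
    (v : Fin 2 → ℝ) : Submodule ℝ ((Fin 2 → ℝ) →ₗ[ℝ] (Fin 5 → ℝ)) where
  carrier := {Q | Q ∈ T ∧ Q v = 0}
  add_mem' := by
    rintro Q Q' ⟨hQ1, hQ2⟩ ⟨hQ'1, hQ'2⟩
    exact ⟨T.add_mem hQ1 hQ'1, by simp [LinearMap.add_apply, hQ2, hQ'2]⟩
  zero_mem' := ⟨T.zero_mem, by simp⟩
  smul_mem' := by
    rintro c Q ⟨hQ1, hQ2⟩
    exact ⟨T.smul_mem c hQ1, by simp [LinearMap.smul_apply, hQ2]⟩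

/-- The asymptotically-isothermic tableau
`W_AI = {Q(q1,q2,p1,p2,r1,r2) ∈ W : p1 = p2}`. -/
noncomputable def WAI : Submodule ℝ ((Fin 2 → ℝ) →ₗ[ℝ] (Fin 5 → ℝ)) where
  carrier := {Q | ∃ q1 q2 p r1 r2 : ℝ, memW Q q1 q2 p p r1 r2}
  add_mem' := by
    rintro Q Q' ⟨a1, a2, a3, a4, a5, h1, h2⟩ ⟨b1, b2, b3, b4, b5, k1, k2⟩
    refine ⟨a1 + b1, a2 + b2, a3 + b3, a4 + b4, a5 + b5, ?_, ?_⟩ <;>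
      · simp only [LinearMap.add_apply, h1, h2, k1, k2]
        funext i; fin_cases i <;> simp <;> ring
  zero_mem' := by
    refine ⟨0, 0, 0, 0, 0, ?_, ?_⟩ <;>
      · funext i; fin_cases i <;> simp
  smul_mem' := by
    rintro c Q ⟨a1, a2, a3, a4, a5, h1, h2⟩
    refine ⟨c * a1, c * a2, c * a3, c * a4, c * a5, ?_, ?_⟩ <;>
      · simp only [LinearMap.smul_apply, h1, h2]
        funext i; fin_cases i <;> simp <;> ring

/-- The linear map out of `ℝ²` with prescribed values on `e1` and `e2`, as a linear
function of these values. -/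
noncomputable def ofValues (M : Type*) [AddCommGroup M] [Module ℝ M] :
    (Fin 2 → M) ≃ₗ[ℝ] ((Fin 2 → ℝ) →ₗ[ℝ] M) :=
  (Pi.basisFun ℝ (Fin 2)).constr ℝ

section ofValues

variable {M : Type*} [AddCommGroup M] [Module ℝ M]

lemma ofValues_e1 (f : Fin 2 → M) : ofValues M f e1 = f 0 := by
  rw [e1, ← Pi.basisFun_apply]
  exact (Pi.basisFun ℝ (Fin 2)).constr_basis ℝ f 0

lemma ofValues_e2 (f : Fin 2 → M) : ofValues M f e2 = f 1 := by
  rw [e2, ← Pi.basisFun_apply]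
  exact (Pi.basisFun ℝ (Fin 2)).constr_basis ℝ f 1

lemma eq_smul_e1_add_smul_e2 (v : Fin 2 → ℝ) : v = v 0 • e1 + v 1 • e2 := by
  funext i; fin_cases i <;> simp [e1, e2]

lemma hom_ext_e1_e2 {f g : (Fin 2 → ℝ) →ₗ[ℝ] M} (h1 : f e1 = g e1) (h2 : f e2 = g e2) :
    f = g := by
  refine LinearMap.ext fun v => ?_
  rw [eq_smul_e1_add_smul_e2 v]
  simp only [map_add, map_smul, h1, h2]

end ofValues

/-- The values on `e1` and `e2` of the element of `WAI` with parameters `(q1, q2, p, r1, r2)`. -/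
noncomputable def valuesWAI : (Fin 5 → ℝ) →ₗ[ℝ] (Fin 2 → Fin 5 → ℝ) where
  toFun x := ![![-(3/2) * x 0, (1/2) * x 0, x 3, x 2, x 4],
    ![(3/2) * x 1, (1/2) * x 1, x 2, x 4, x 3]]
  map_add' x y := by
    funext i j; fin_cases i <;> fin_cases j <;> simp <;> ring
  map_smul' c x := by
    funext i j; fin_cases i <;> fin_cases j <;> simp <;> ring

/-- The parametrization of `WAI` by `(q1, q2, p, r1, r2)`. -/
noncomputable def paramWAI : (Fin 5 → ℝ) →ₗ[ℝ] ((Fin 2 → ℝ) →ₗ[ℝ] (Fin 5 → ℝ)) :=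
  (ofValues (Fin 5 → ℝ)).toLinearMap ∘ₗ valuesWAI

lemma paramWAI_e1 (x : Fin 5 → ℝ) :
    paramWAI x e1 = ![-(3/2) * x 0, (1/2) * x 0, x 3, x 2, x 4] :=
  ofValues_e1 _

lemma paramWAI_e2 (x : Fin 5 → ℝ) :
    paramWAI x e2 = ![(3/2) * x 1, (1/2) * x 1, x 2, x 4, x 3] :=
  ofValues_e2 _

lemma paramWAI_injective : Function.Injective paramWAI := by
  intro x y h
  have h1 := LinearMap.congr_fun h e1
  have h2 := LinearMap.congr_fun h e2
  rw [paramWAI_e1, paramWAI_e1] at h1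
  rw [paramWAI_e2, paramWAI_e2] at h2
  simp only [Matrix.vecCons_inj] at h1 h2
  funext i
  fin_cases i <;> simp <;> linarith

lemma range_paramWAI : LinearMap.range paramWAI = WAI := by
  ext Q
  constructor
  · rintro ⟨x, rfl⟩
    exact ⟨x 0, x 1, x 2, x 3, x 4, paramWAI_e1 x, paramWAI_e2 x⟩
  · rintro ⟨q1, q2, p, r1, r2, h1, h2⟩
    refine ⟨![q1, q2, p, r1, r2], hom_ext_e1_e2 ?_ ?_⟩
    · rw [paramWAI_e1, h1]; simp
    · rw [paramWAI_e2, h2]; simp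

lemma finrank_WAI : finrank ℝ WAI = 5 := by
  rw [← range_paramWAI, LinearMap.finrank_range_of_inj paramWAI_injective]
  simp

/-- The parameters of the values on `e1` and `e2` of an element of `prolong WAI`. -/
noncomputable def valuesProlongWAI : (Fin 5 → ℝ) →ₗ[ℝ] (Fin 2 → Fin 5 → ℝ) where
  toFun x := ![![x 0, 0, x 2, x 3, x 4], ![0, x 1, x 4, x 2, x 3]]
  map_add' x y := by
    funext i j; fin_cases i <;> fin_cases j <;> simp
  map_smul' c x := by
    funext i j; fin_cases i <;> fin_cases j <;> simp

/-- The parametrization of `prolong WAI`. -/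
noncomputable def paramProlongWAI :
    (Fin 5 → ℝ) →ₗ[ℝ] ((Fin 2 → ℝ) →ₗ[ℝ] ((Fin 2 → ℝ) →ₗ[ℝ] (Fin 5 → ℝ))) :=
  (ofValues ((Fin 2 → ℝ) →ₗ[ℝ] (Fin 5 → ℝ))).toLinearMap ∘ₗ
    paramWAI.compLeft (Fin 2) ∘ₗ valuesProlongWAI

lemma paramProlongWAI_e1 (x : Fin 5 → ℝ) :
    paramProlongWAI x e1 = paramWAI ![x 0, 0, x 2, x 3, x 4] :=
  ofValues_e1 _

lemma paramProlongWAI_e2 (x : Fin 5 → ℝ) :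
    paramProlongWAI x e2 = paramWAI ![0, x 1, x 4, x 2, x 3] :=
  ofValues_e2 _

lemma paramProlongWAI_injective : Function.Injective paramProlongWAI := by
  intro x y h
  have h1 := LinearMap.congr_fun h e1
  have h2 := LinearMap.congr_fun h e2
  rw [paramProlongWAI_e1, paramProlongWAI_e1] at h1
  rw [paramProlongWAI_e2, paramProlongWAI_e2] at h2
  replace h1 := paramWAI_injective h1
  replace h2 := paramWAI_injective h2
  simp only [Matrix.vecCons_inj] at h1 h2
  funext i
  fin_cases i <;> simp <;> linarith

lemma range_paramProlongWAI : LinearMap.range paramProlongWAI = prolong WAI := by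
  ext F
  constructor
  · rintro ⟨x, rfl⟩
    refine ⟨fun v => ?_, ?_⟩
    · rw [eq_smul_e1_add_smul_e2 v, map_add, map_smul, map_smul, paramProlongWAI_e1,
        paramProlongWAI_e2, ← range_paramWAI]
      exact add_mem (Submodule.smul_mem _ _ ⟨_, rfl⟩) (Submodule.smul_mem _ _ ⟨_, rfl⟩)
    · rw [paramProlongWAI_e1, paramProlongWAI_e2, paramWAI_e1, paramWAI_e2]
      simp
  · rintro ⟨hF, hsymm⟩
    obtain ⟨a, ha⟩ : F e1 ∈ LinearMap.range paramWAI := range_paramWAI ▸ hF e1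
    obtain ⟨b, hb⟩ : F e2 ∈ LinearMap.range paramWAI := range_paramWAI ▸ hF e2
    rw [← ha, ← hb, paramWAI_e1, paramWAI_e2] at hsymm
    simp only [Matrix.vecCons_inj] at hsymm
    obtain ⟨h0, h1, h2, h3, h4, -⟩ := hsymm
    refine ⟨![a 0, b 1, a 2, a 3, a 4], hom_ext_e1_e2 ?_ ?_⟩
    · rw [paramProlongWAI_e1, ← ha]
      congr 1
      funext i
      fin_cases i <;> simp <;> linarith
    · rw [paramProlongWAI_e2, ← hb]
      congr 1
      funext i
      fin_cases i <;> simp <;> linarith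

lemma finrank_prolong_WAI : finrank ℝ (prolong WAI) = 5 := by
  rw [← range_paramProlongWAI]
  exact (LinearMap.finrank_range_of_inj paramProlongWAI_injective).trans (by simp)

lemma WAI_le_W : WAI ≤ W := by
  rintro Q ⟨q1, q2, p, r1, r2, h⟩
  exact ⟨q1, q2, p, p, r1, r2, h⟩

lemma vanishAt_WAI_eq_bot {lam mu : ℝ} (h : lam * mu * (lam ^ 3 + mu ^ 3) ≠ 0) :
    vanishAt WAI (lam • e1 + mu • e2) = ⊥ := by
  refine (Submodule.eq_bot_iff _).2 ?_
  rintro Q ⟨⟨q1, q2, p, r1, r2, h1, h2⟩, hv⟩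
  have hlam : lam ≠ 0 := by rintro rfl; simp at h
  have hmu : mu ≠ 0 := by rintro rfl; simp at h
  have hdet : lam ^ 3 + mu ^ 3 ≠ 0 := right_ne_zero_of_mul h
  rw [map_add, map_smul, map_smul, h1, h2] at hv
  have c0 := congrFun hv 0
  have c1 := congrFun hv 1
  have c2 := congrFun hv 2
  have c3 := congrFun hv 3
  have c4 := congrFun hv 4
  simp at c0 c1 c2 c3 c4
  have hq1 : q1 = 0 := mul_left_cancel₀ hlam (by linarith)
  have hq2 : q2 = 0 := mul_left_cancel₀ hmu (by linarith)
  have hp : p = 0 := mul_left_cancel₀ hdet (by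
    linear_combination mu ^ 2 * c2 + lam ^ 2 * c3 - lam * mu * c4)
  have hr1 : r1 = 0 := mul_left_cancel₀ hlam (by linear_combination c2 - mu * hp)
  have hr2 : r2 = 0 := mul_left_cancel₀ hmu (by linear_combination c3 - lam * hp)
  subst hq1 hq2 hp hr1 hr2
  refine hom_ext_e1_e2 ?_ ?_
  · rw [h1]; simp
  · rw [h2]; simp

/-- The asymptotically-isothermic tableau
`W_AI = {Q(q1,q2,p1,p2,r1,r2) ∈ W : p1 = p2}` is a 5-dimensional subspace of
the Fubini–Cartan tableau `W`, its first prolongation `W_AI⁽¹⁾` has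
dimension 5, and for all real `λ, μ` with `λ·μ·(λ³ + μ³) ≠ 0` the subspace
`{Q ∈ W_AI : Q(λ·e1 + μ·e2) = 0}` is zero.  Hence `W_AI` is involutive with
characters `s'_1 = 5` and `s'_2 = 0`: `dim W_AI⁽¹⁾ = 5 = s'_1 + 2·s'_2`. -/
theorem asymptoticallyIsothermic_involutive :
    WAI ≤ W ∧
    finrank ℝ WAI = 5 ∧
    finrank ℝ (prolong WAI) = 5 ∧
    (∀ lam mu : ℝ, lam * mu * (lam ^ 3 + mu ^ 3) ≠ 0 →
      vanishAt WAI (lam • e1 + mu • e2) = ⊥) ∧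
    finrank ℝ (prolong WAI) = 5 + 2 * 0 := by
  exact ⟨WAI_le_W, finrank_WAI, finrank_prolong_WAI, fun _ _ h => vanishAt_WAI_eq_bot h,
    finrank_prolong_WAI⟩
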